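/- Fix (p,q) ∈ ℤ². The following are equivalent: (i) the double complex satisfies the d'd''-lemma at (p,q), i.e., Im d' ∩ ker d'' ∩ A^{p,q} = Im d'd'' ∩ A^{p,q} and ker d' ∩ Im d'' ∩ A^{p,q} = Im d'd'' ∩ A^{p,q}; (ii) ker d'd'' ∩ A^{p-1,q} = (ker d' + Im d'') ∩ A^{p-1,q} and ker d'd'' ∩ A^{p,q-1} = (Im d' + ker d'') ∩ A^{p,q-1} (i.e., the natural maps H_{d'}^{p-1,q} → H_A^{p-1,q} and H_{d''}^{p,q-1} → H_A^{p,q-1} are surjective). -/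

import Mathlib

open Submodule

/-- A double complex of complex vector spaces, realized as an internally bigraded
module `W = ⊕_{p,q} A p q` together with global differentials `d'`, `d''` of
bidegrees `(1,0)` and `(0,1)` satisfying `d'∘d' = 0`, `d''∘d'' = 0` and
`d'∘d'' + d''∘d' = 0`. -/
structure BiComplex (W : Type*) [AddCommGroup W] [Module ℂ W] where
  A : ℤ → ℤ → Submodule ℂ W
  d' : W →ₗ[ℂ] W
  d'' : W →ₗ[ℂ] W
  internal : DirectSum.IsInternal (fun pq : ℤ × ℤ => A pq.1 pq.2)
  map_d' : ∀ p q : ℤ, (A p q).map d' ≤ A (p + 1) q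
  map_d'' : ∀ p q : ℤ, (A p q).map d'' ≤ A p (q + 1)
  d'_sq : d' ∘ₗ d' = 0
  d''_sq : d'' ∘ₗ d'' = 0
  anticomm : d' ∘ₗ d'' + d'' ∘ₗ d' = 0

namespace BiComplex

variable {W : Type*} [AddCommGroup W] [Module ℂ W] (C : BiComplex W)

/-- `ker d' ∩ A^{p,q}` : the kernel of `d' : A^{p,q} → A^{p+1,q}`. -/
def kerd' (p q : ℤ) : Submodule ℂ W := LinearMap.ker C.d' ⊓ C.A p q

/-- `ker d'' ∩ A^{p,q}` : the kernel of `d'' : A^{p,q} → A^{p,q+1}`. -/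
def kerd'' (p q : ℤ) : Submodule ℂ W := LinearMap.ker C.d'' ⊓ C.A p q

/-- `Im d' ∩ A^{p,q} = d'(A^{p-1,q})`. -/
def imd' (p q : ℤ) : Submodule ℂ W := (C.A (p - 1) q).map C.d'

/-- `Im d'' ∩ A^{p,q} = d''(A^{p,q-1})`. -/
def imd'' (p q : ℤ) : Submodule ℂ W := (C.A p (q - 1)).map C.d''

/-- `Im d'd'' ∩ A^{p,q} = (d'∘d'')(A^{p-1,q-1})`. -/
def imd'd'' (p q : ℤ) : Submodule ℂ W := (C.A (p - 1) (q - 1)).map (C.d' ∘ₗ C.d'')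

/-- `ker d'd'' ∩ A^{p,q}` : the kernel of `d'∘d'' : A^{p,q} → A^{p+1,q+1}`. -/
def kerd'd'' (p q : ℤ) : Submodule ℂ W := LinearMap.ker (C.d' ∘ₗ C.d'') ⊓ C.A p q

/-- The `d'd''`-lemma at `(p,q)`:
`Im d' ∩ ker d'' ∩ A^{p,q} = ker d' ∩ Im d'' ∩ A^{p,q} = Im d'd'' ∩ A^{p,q}`. -/
def DDLemmaAt (p q : ℤ) : Prop :=
  C.imd' p q ⊓ C.kerd'' p q = C.imd'd'' p q ∧ C.kerd' p q ⊓ C.imd'' p q = C.imd'd'' p q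

/-- The total-degree piece `A^k = ⊕_{p+q=k} A^{p,q}`. -/
def Atot (k : ℤ) : Submodule ℂ W := ⨆ p : ℤ, C.A p (k - p)

/-- The total differential `d = d' + d''`. -/
def dtot : W →ₗ[ℂ] W := C.d' + C.d''

/-- `ker d ∩ A^k` : the kernel of `d : A^k → A^{k+1}`. -/
def kerdTot (k : ℤ) : Submodule ℂ W := LinearMap.ker C.dtot ⊓ C.Atot k

/-- `Im d ∩ A^k = d(A^{k-1})`. -/
def imdTot (k : ℤ) : Submodule ℂ W := (C.Atot (k - 1)).map C.dtot

/-- `ker d' ∩ ker d'' ∩ A^k = ⊕_{p+q=k} (ker d' ∩ ker d'' ∩ A^{p,q})`. -/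
def kerd'kerd''Tot (k : ℤ) : Submodule ℂ W :=
  ⨆ p : ℤ, (C.kerd' p (k - p) ⊓ C.kerd'' p (k - p))

/-- `Im d'd'' ∩ A^k = ⊕_{p+q=k} (Im d'd'' ∩ A^{p,q})`. -/
def imd'd''Tot (k : ℤ) : Submodule ℂ W := ⨆ p : ℤ, C.imd'd'' p (k - p)

/-- `ker d'd'' ∩ A^k = ⊕_{p+q=k} (ker d'd'' ∩ A^{p,q})`. -/
def kerd'd''Tot (k : ℤ) : Submodule ℂ W := ⨆ p : ℤ, C.kerd'd'' p (k - p)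

/-- `Im d' ∩ A^k = ⊕_{p+q=k} (Im d' ∩ A^{p,q})`. -/
def imd'Tot (k : ℤ) : Submodule ℂ W := ⨆ p : ℤ, C.imd' p (k - p)

/-- `Im d'' ∩ A^k = ⊕_{p+q=k} (Im d'' ∩ A^{p,q})`. -/
def imd''Tot (k : ℤ) : Submodule ℂ W := ⨆ p : ℤ, C.imd'' p (k - p)

/-- The double complex is totally bounded: `A^{p,q} = 0` for `|p| > N` or `|q| > N`. -/
def TotallyBounded : Prop :=
  ∃ N : ℕ, ∀ p q : ℤ, ((N : ℤ) < |p| ∨ (N : ℤ) < |q|) → C.A p q = ⊥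

end BiComplex

/-- The quotient vector space `S / T` of a submodule `S` by (the trace of) a
submodule `T ≤ S`. -/
abbrev quotSub {W : Type*} [AddCommGroup W] [Module ℂ W] (S T : Submodule ℂ W) :=
  S ⧸ (Submodule.comap S.subtype T)

/-- For anticommuting `f`, `g` with `g ∘ g = 0` and subspaces `g(B) ⊆ M`, `f(M) ⊆ N`, one has
`f(M) ∩ ker g ∩ N = (f ∘ g)(B)` if and only if `ker (f ∘ g) ∩ M = ker f ∩ M + g(B)`. -/
theorem map_inf_ker_eq_map_comp_iff {W : Type*} [AddCommGroup W] [Module ℂ W]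
    {f g : W →ₗ[ℂ] W} {B M N : Submodule ℂ W} (hg : g ∘ₗ g = 0) (hfg : f ∘ₗ g + g ∘ₗ f = 0)
    (hB : B.map g ≤ M) (hM : M.map f ≤ N) :
    M.map f ⊓ (LinearMap.ker g ⊓ N) = B.map (f ∘ₗ g) ↔
      LinearMap.ker (f ∘ₗ g) ⊓ M = (LinearMap.ker f ⊓ M) ⊔ B.map g := by
  have hgg : ∀ x, g (g x) = 0 := fun x => LinearMap.congr_fun hg x
  have hanti : ∀ x, g (f x) = -f (g x) := fun x =>
    eq_neg_of_add_eq_zero_right (LinearMap.congr_fun hfg x)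
  constructor
  · intro h
    apply le_antisymm
    · rintro x ⟨hx, hxM⟩
      have hx' : f (g x) = 0 := hx
      have hfx : f x ∈ M.map f ⊓ (LinearMap.ker g ⊓ N) :=
        ⟨mem_map_of_mem hxM, by simp [hanti, hx'], hM (mem_map_of_mem hxM)⟩
      rw [h] at hfx
      obtain ⟨y, hy, hyx⟩ := hfx
      have hyx' : f (g y) = f x := hyx
      refine mem_sup.2 ⟨x - g y, ⟨?_, ?_⟩, g y, mem_map_of_mem hy, sub_add_cancel _ _⟩
      · simp [hyx']
      · exact M.sub_mem hxM (hB (mem_map_of_mem hy))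
    · refine sup_le ?_ ?_
      · rintro x ⟨hx, hxM⟩
        have hx' : f x = 0 := hx
        have hgx : g (f x) = -f (g x) := hanti x
        refine ⟨?_, hxM⟩
        simpa [hx'] using hgx
      · rintro _ ⟨y, hy, rfl⟩
        exact ⟨by simp [hgg], hB (mem_map_of_mem hy)⟩
  · intro h
    apply le_antisymm
    · rintro _ ⟨⟨x, hxM, rfl⟩, hx, -⟩
      have hx' : g (f x) = 0 := hx
      have hxk : x ∈ LinearMap.ker (f ∘ₗ g) ⊓ M :=
        ⟨by simpa [hanti] using hx', hxM⟩
      rw [h] at hxk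
      obtain ⟨k, ⟨hk, -⟩, _, ⟨y, hy, rfl⟩, rfl⟩ := mem_sup.1 hxk
      have hk' : f k = 0 := hk
      exact ⟨y, hy, by simp [hk']⟩
    · rintro _ ⟨y, hy, rfl⟩
      have hgy : g y ∈ M := hB (mem_map_of_mem hy)
      exact ⟨mem_map_of_mem hgy, by simp [hanti, hgg], hM (mem_map_of_mem hgy)⟩

/-- Fix `(p,q)`.  The `d'd''`-lemma holds at `(p,q)` iff
`ker d'd'' ∩ A^{p-1,q} = (ker d' + Im d'') ∩ A^{p-1,q}` and
`ker d'd'' ∩ A^{p,q-1} = (Im d' + ker d'') ∩ A^{p,q-1}` (i.e. the natural maps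
`H_{d'}^{p-1,q} → H_A^{p-1,q}` and `H_{d''}^{p,q-1} → H_A^{p,q-1}` are
surjective). -/
theorem bicomplex_ddlemma_at_iff_psi_pm_surj
    {W : Type*} [AddCommGroup W] [Module ℂ W] (C : BiComplex W) (p q : ℤ) :
    C.DDLemmaAt p q ↔
      (C.kerd'd'' (p - 1) q = C.kerd' (p - 1) q ⊔ C.imd'' (p - 1) q ∧
        C.kerd'd'' p (q - 1) = C.imd' p (q - 1) ⊔ C.kerd'' p (q - 1)) := by
  have hneg : C.d' ∘ₗ C.d'' = -(C.d'' ∘ₗ C.d') := eq_neg_of_add_eq_zero_left C.anticomm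
  have hker : LinearMap.ker (C.d' ∘ₗ C.d'') = LinearMap.ker (C.d'' ∘ₗ C.d') := by
    ext x
    simp [hneg]
  have himg : (C.A (p - 1) (q - 1)).map (C.d' ∘ₗ C.d'') =
      (C.A (p - 1) (q - 1)).map (C.d'' ∘ₗ C.d') := by
    rw [hneg, Submodule.map_neg]
  have hp : p - 1 + 1 = p := sub_add_cancel p 1
  have hq : q - 1 + 1 = q := sub_add_cancel q 1
  refine and_congr ?_ ?_
  · exact map_inf_ker_eq_map_comp_iff C.d''_sq C.anticomm
      (by simpa only [hq] using C.map_d'' (p - 1) (q - 1))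
      (by simpa only [hp] using C.map_d' (p - 1) q)
  · unfold BiComplex.kerd' BiComplex.imd'' BiComplex.imd'd'' BiComplex.kerd'd'' BiComplex.imd'
      BiComplex.kerd''
    rw [himg, hker, inf_comm, sup_comm]
    exact map_inf_ker_eq_map_comp_iff C.d'_sq ((add_comm _ _).trans C.anticomm)
      (by simpa only [hp] using C.map_d' (p - 1) (q - 1))
      (by simpa only [hq] using C.map_d'' p (q - 1))
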